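/- arXiv:0806.3463 — 3 statements merged into one kernel-verified Lean document; each statement's English description precedes it below -/
import Mathlib

section
/- For every integer i ≥ 1, the ideal of F_q[T] generated by the set of values { f^{q^i} − f : f ∈ F_q[T] } equals the principal ideal generated by the product of all monic irreducible polynomials in F_q[T] whose degree divides i. -/
open Polynomial

/-- Over a finite field with `q` elements, raising a polynomial to the power `q ^ n` is the
substitution `X ↦ X ^ q ^ n`. -/
theorem FiniteField.expand_card_pow {F : Type*} [Field F] [Fintype F] (n : ℕ) (f : F[X]) :
    expand F (Fintype.card F ^ n) f = f ^ Fintype.card F ^ n := by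
  induction n with
  | zero => simp
  | succ n ih => rw [pow_succ', expand_mul, ih, map_pow, FiniteField.expand_card, ← pow_mul]

/-- `X ^ q ^ n - X` divides every value `f ^ q ^ n - f`. -/
theorem FiniteField.X_pow_card_pow_sub_X_dvd {F : Type*} [Field F] [Fintype F] (n : ℕ)
    (f : F[X]) : (X ^ Fintype.card F ^ n - X : F[X]) ∣ f ^ Fintype.card F ^ n - f := by
  have h := sub_dvd_eval_sub (X ^ Fintype.card F ^ n : F[X]) X (f.map C)
  rwa [eval_map, eval_map, eval₂_C_X, ← comp, ← expand_eq_comp_X_pow, expand_card_pow] at h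

/-- The ideal generated by the values `f ^ q ^ n - f` is generated by the value at `f = X`. -/
theorem FiniteField.span_pow_card_pow_sub_self {F : Type*} [Field F] [Fintype F] (n : ℕ) :
    Ideal.span {h : F[X] | ∃ f : F[X], h = f ^ Fintype.card F ^ n - f}
      = Ideal.span {X ^ Fintype.card F ^ n - X} := by
  apply le_antisymm
  · rw [Ideal.span_le]
    rintro _ ⟨f, rfl⟩
    exact Ideal.mem_span_singleton.mpr (X_pow_card_pow_sub_X_dvd n f)
  · exact Ideal.span_mono (Set.singleton_subset_iff.mpr ⟨X, rfl⟩)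

theorem FiniteField.separable_X_pow_card_pow_sub_X {F : Type*} [Field F] [Fintype F] {n : ℕ}
    (hn : n ≠ 0) : (X ^ Fintype.card F ^ n - X : F[X]).Separable := by
  obtain ⟨p, hp⟩ := CharP.exists F
  refine galois_poly_separable p _ (dvd_pow ?_ hn)
  rw [← CharP.cast_eq_zero_iff F p, Nat.cast_card_eq_zero]

/-- If `S` is the set of monic irreducible polynomials of degree dividing `n`, then its product
is `X ^ q ^ n - X` up to a unit. -/
theorem FiniteField.associated_prod_irreducible {F : Type*} [Field F] [Fintype F] {n : ℕ}
    (hn : n ≠ 0) (S : Finset F[X])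
    (hS : ∀ g : F[X], g ∈ S ↔ g.Monic ∧ Irreducible g ∧ g.natDegree ∣ n) :
    Associated (∏ g ∈ S, g) (X ^ Fintype.card F ^ n - X) := by
  classical
  have h0 : (X ^ Fintype.card F ^ n - X : F[X]) ≠ 0 :=
    X_pow_card_pow_sub_X_ne_zero F hn Fintype.one_lt_card
  have hnodup := (UniqueFactorizationMonoid.squarefree_iff_nodup_normalizedFactors h0).mp
    (separable_X_pow_card_pow_sub_X hn).squarefree
  have hval : S.val = UniqueFactorizationMonoid.normalizedFactors
      (X ^ Fintype.card F ^ n - X : F[X]) := by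
    refine (Multiset.Nodup.ext S.nodup hnodup).mpr fun g ↦ ?_
    rw [Finset.mem_val, hS, Polynomial.mem_normalizedFactors_iff h0]
    have hdvd (hg : Irreducible g) := hg.natDegree_dvd_iff_dvd_X_pow_card_pow_sub_X (n := n)
    rw [Nat.card_eq_fintype_card] at hdvd
    tauto
  rw [Finset.prod_eq_multiset_prod, hval, Multiset.map_id']
  exact UniqueFactorizationMonoid.prod_normalizedFactors h0

/-- For `i ≥ 1`, the ideal of `F_q[T]` generated by the values
`f^{q^i} − f`, `f ∈ F_q[T]`, equals the principal ideal generated by the product of all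
monic irreducible polynomials of degree dividing `i`. -/
theorem ideal_of_values_eq_prod_irreducibles (p q : ℕ) (hp : p.Prime)
    (hq : ∃ n : ℕ, 0 < n ∧ q = p ^ n)
    (F : Type*) [Field F] [Fintype F] (hF : Fintype.card F = q)
    (i : ℕ) (hi : 1 ≤ i)
    (S : Finset (Polynomial F))
    (hS : ∀ g : Polynomial F, g ∈ S ↔ g.Monic ∧ Irreducible g ∧ g.natDegree ∣ i) :
    Ideal.span {h : Polynomial F | ∃ f : Polynomial F, h = f ^ q ^ i - f}
      = Ideal.span {∏ g ∈ S, g} := by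
  subst hF
  rw [FiniteField.span_pow_card_pow_sub_self, eq_comm, Ideal.span_singleton_eq_span_singleton]
  exact FiniteField.associated_prod_irreducible (Nat.one_le_iff_ne_zero.mp hi) S hS
end

section
/- Let P be a monic irreducible polynomial of degree d in F_q[T] and let j be a nonnegative integer with q-adic expansion j = Σ_e c_e q^e (0 ≤ c_e < q). Then the P-adic valuation of the Carlitz factorial Π_j(T) := ∏_{e≥0} D_e(T)^{c_e} equals Σ_{e≥1} ⌊ j / q^{ed} ⌋, where ⌊·⌋ is the greatest-integer function. -/
open Polynomial

/-- `D_e(T) := ∏_{m=1}^{e} (T^{q^m} − T)^{q^{e−m}}` (so `D_0 = 1`). -/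
noncomputable def carlitzD (q : ℕ) (F : Type*) [Field F] (e : ℕ) : Polynomial F :=
  ∏ m ∈ Finset.Icc 1 e, (X ^ q ^ m - X) ^ q ^ (e - m)

/-- The Carlitz factorial `Π_j(T) := ∏_{e ≥ 0} D_e(T)^{c_e}`, where the `c_e` are the
`q`-adic digits of `j` (the digits vanish for `e > j`, so the range below suffices). -/
noncomputable def carlitzFactorial (q : ℕ) (F : Type*) [Field F] (j : ℕ) : Polynomial F :=
  ∏ e ∈ Finset.range (j + 1), (carlitzD q F e) ^ (j / q ^ e % q)

theorem emultiplicity_X_pow_card_pow_sub_X {F : Type*} [Field F] [Fintype F]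
    {P : F[X]} (hP : Irreducible P) {m : ℕ} (hm : m ≠ 0) :
    emultiplicity P (X ^ Fintype.card F ^ m - X) =
      ((if P.natDegree ∣ m then 1 else 0 : ℕ) : ℕ∞) := by
  have hdvd := hP.natDegree_dvd_iff_dvd_X_pow_card_pow_sub_X (n := m)
  rw [Nat.card_eq_fintype_card] at hdvd
  split_ifs with h
  · rw [emultiplicity_eq_coe]
    refine ⟨by simpa using hdvd.mp h, fun hsq => ?_⟩
    have hzero : ((Fintype.card F ^ m : ℕ) : F) = 0 := by
      rw [Nat.cast_pow, Nat.cast_card_eq_zero, zero_pow hm]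
    have hsep : (X ^ Fintype.card F ^ m - X : F[X]).Separable := by
      rw [separable_def]
      refine ⟨0, -1, ?_⟩
      rw [derivative_sub, derivative_X_pow, derivative_X, hzero]
      simp
    exact hP.not_isUnit (hsep.squarefree P (by simpa [pow_two] using hsq))
  · simpa using emultiplicity_eq_zero.mpr (fun hd => h (hdvd.mpr hd))

theorem sum_pow_sub_dvd_eq {q d e N : ℕ} (hq : 1 < q) (hd : 0 < d) (he : e ≤ N) :
    ∑ m ∈ Finset.Icc 1 e, q ^ (e - m) * (if d ∣ m then 1 else 0) =
      ∑ k ∈ Finset.Icc 1 N, q ^ e / q ^ (k * d) := by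
  have hterm : ∀ k ∈ Finset.Icc 1 N, q ^ e / q ^ (k * d) =
      ∑ m ∈ Finset.Icc 1 e, if m = k * d then q ^ (e - m) else 0 := by
    intro k hk
    have hk1 : 1 ≤ k := (Finset.mem_Icc.mp hk).1
    have hpos : 1 ≤ k * d := Nat.mul_pos hk1 hd
    simp only [Finset.sum_ite_eq', Finset.mem_Icc]
    split_ifs with h
    · exact Nat.pow_div h.2 (by lia)
    · exact Nat.div_eq_of_lt (Nat.pow_lt_pow_right hq (by lia))
  rw [Finset.sum_congr rfl hterm, Finset.sum_comm]
  refine Finset.sum_congr rfl fun m hm => ?_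
  rw [Finset.mem_Icc] at hm
  split_ifs with h
  · obtain ⟨k, rfl⟩ := h
    have hk : k ∈ Finset.Icc 1 N := by
      rw [Finset.mem_Icc]
      exact ⟨Nat.pos_of_ne_zero (by rintro rfl; simp at hm), by nlinarith⟩
    rw [Finset.sum_eq_single_of_mem k hk, if_pos (mul_comm d k), mul_one]
    intro b _ hb
    exact if_neg fun h => hb (Nat.eq_of_mul_eq_mul_right hd (by rw [← h, mul_comm]))
  · rw [mul_zero]
    refine (Finset.sum_eq_zero fun k _ => if_neg ?_).symm
    rintro rfl
    exact h (dvd_mul_left d k)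

theorem sum_digits_mul_pow_div_pow {q : ℕ} (hq : 1 < q) (j n : ℕ) :
    ∑ e ∈ Finset.range (j + 1), (j / q ^ e % q) * (q ^ e / q ^ n) = j / q ^ n := by
  have hsmall : ∀ N ≤ n, ∑ e ∈ Finset.range N, (j / q ^ e % q) * (q ^ e / q ^ n) = 0 := by
    refine fun N hN => Finset.sum_eq_zero fun e he => ?_
    rw [Nat.div_eq_of_lt (Nat.pow_lt_pow_right hq (by have := Finset.mem_range.mp he; lia)),
      mul_zero]
  have hlt : j < q ^ (j + 1) := (Nat.lt_succ_self j).trans (Nat.lt_pow_self hq)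
  rcases le_total (j + 1) n with h | h
  · rw [hsmall _ h, Nat.div_eq_of_lt (hlt.trans_le (Nat.pow_le_pow_right (by lia) h))]
  · have hpart : ∀ N, n ≤ N → ∑ e ∈ Finset.range N, (j / q ^ e % q) * (q ^ e / q ^ n) +
        q ^ (N - n) * (j / q ^ N) = j / q ^ n := by
      intro N hN
      induction N, hN using Nat.le_induction with
      | base => simp [hsmall n le_rfl]
      | succ N hN ih =>
        rw [← ih, Finset.sum_range_succ, Nat.pow_div hN (by lia), Nat.sub_add_comm hN,
          pow_succ q (N - n), pow_succ q N, ← Nat.div_div_eq_div_mul]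
        conv_rhs => rw [← Nat.mod_add_div (j / q ^ N) q]
        ring
    simpa [Nat.div_eq_of_lt hlt] using hpart _ h

theorem emultiplicity_carlitzD {F : Type*} [Field F] [Fintype F] {P : F[X]}
    (hP : Irreducible P) {e N : ℕ} (he : e ≤ N) :
    emultiplicity P (carlitzD (Fintype.card F) F e) =
      ((∑ k ∈ Finset.Icc 1 N, Fintype.card F ^ e / Fintype.card F ^ (k * P.natDegree) : ℕ) :
        ℕ∞) := by
  rw [← sum_pow_sub_dvd_eq Fintype.one_lt_card hP.natDegree_pos he, carlitzD,
    Finset.emultiplicity_prod hP.prime, Nat.cast_sum]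
  refine Finset.sum_congr rfl fun m hm => ?_
  have hm : m ≠ 0 := by have := (Finset.mem_Icc.mp hm).1; lia
  rw [emultiplicity_pow hP.prime, emultiplicity_X_pow_card_pow_sub_X hP hm, Nat.cast_mul]

/-- for a monic irreducible `P` of degree `d` in `F_q[T]`, the `P`-adic
valuation of the Carlitz factorial `Π_j(T)` equals `Σ_{e ≥ 1} ⌊j / q^{ed}⌋`
(the terms with `e > j` vanish, so the finite sum below suffices). -/
theorem valuation_carlitzFactorial (p q : ℕ) (hp : p.Prime)
    (hq : ∃ n : ℕ, 0 < n ∧ q = p ^ n)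
    (F : Type*) [Field F] [Fintype F] (hF : Fintype.card F = q)
    (P : Polynomial F) (hPmonic : P.Monic) (hPirr : Irreducible P)
    (d : ℕ) (hd : P.natDegree = d) (j : ℕ) :
    multiplicity P (carlitzFactorial q F j) = ∑ e ∈ Finset.Icc 1 j, j / q ^ (e * d) := by
  subst hF hd
  apply multiplicity_eq_of_emultiplicity_eq_some
  rw [carlitzFactorial, Finset.emultiplicity_prod hPirr.prime]
  rw [Finset.sum_congr rfl fun k _ =>
    (sum_digits_mul_pow_div_pow (Fintype.one_lt_card (α := F)) j (k * P.natDegree)).symm,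
    Finset.sum_comm, Nat.cast_sum]
  refine Finset.sum_congr rfl fun e he => ?_
  rw [emultiplicity_pow hPirr.prime,
    emultiplicity_carlitzD hPirr (Nat.lt_succ_iff.mp (Finset.mem_range.mp he)),
    ← Finset.mul_sum, Nat.cast_mul]
end

section
/- Let p be a prime and ρ a permutation of ℕ, and let ρ_* be the induced p-adic digit permutation (the case q = p). Then for all natural numbers i and j, C(i + j, i) ≡ C(ρ_*(i) + ρ_*(j), ρ_*(i)) (mod p). -/
/-- The digit permutation map on natural numbers: if `n = Σ_i c_i q^i` `q`-adically, then
`rhoStar q ρ n = Σ_i c_i q^{ρ(i)}`; here we use it with `q = p`. -/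
def rhoStar (q : ℕ) (ρ : Equiv.Perm ℕ) (n : ℕ) : ℕ :=
  ∑ i ∈ Finset.range (n + 1), (n / q ^ i % q) * q ^ (ρ i)


open Finset in
theorem prod_range_eq_prod_range_perm_symm {M : Type*} [CommMonoid M] (ρ : Equiv.Perm ℕ)
    {f : ℕ → M} {n L : ℕ} (hf : ∀ k, n ≤ k → f k = 1) (hL : ∀ k < n, ρ k < L) :
    ∏ k ∈ range n, f k = ∏ m ∈ range L, f (ρ.symm m) := by
  have h : ∏ k ∈ range n, f k = ∏ m ∈ (range n).map ρ.toEmbedding, f (ρ.symm m) := by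
    simp
  rw [h]
  refine prod_subset (fun m hm => ?_) (fun m _ hm => hf _ ?_)
  · obtain ⟨k, hk, rfl⟩ := mem_map.1 hm
    exact mem_range.2 (hL k (mem_range.1 hk))
  · by_contra! h
    exact hm (mem_map.2 ⟨ρ.symm m, mem_range.2 h, by simp⟩)

open Finset in
theorem sum_range_eq_sum_range_perm_symm {M : Type*} [AddCommMonoid M] (ρ : Equiv.Perm ℕ)
    {f : ℕ → M} {n L : ℕ} (hf : ∀ k, n ≤ k → f k = 0) (hL : ∀ k < n, ρ k < L) :
    ∑ k ∈ range n, f k = ∑ m ∈ range L, f (ρ.symm m) :=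
  prod_range_eq_prod_range_perm_symm (M := Multiplicative M) ρ hf hL

theorem Nat.sum_range_div_pow_mod_mul_pow (q n N : ℕ) :
    ∑ k ∈ Finset.range N, (n / q ^ k % q) * q ^ k = n % q ^ N := by
  induction N with
  | zero => simp [Nat.mod_one]
  | succ N ih => rw [Finset.sum_range_succ, ih, Nat.mod_pow_succ, mul_comm]

/-- If adding `a` and `b` produces a carry in the lowest digit, both sides vanish modulo `p`;
otherwise this is Lucas' theorem. -/
theorem Nat.choose_add_modEq_choose_digit_mul {p : ℕ} (hp : p.Prime) {a b : ℕ} (ha : a < p)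
    (hb : b < p) (x y : ℕ) :
    (a + p * x + (b + p * y)).choose (a + p * x) ≡
      (a + b).choose a * (x + y).choose x [MOD p] := by
  have : Fact p.Prime := ⟨hp⟩
  have e : a + p * x + (b + p * y) = a + b + p * (x + y) := by ring
  have h₁ := Choose.choose_modEq_choose_mod_mul_choose_div_nat (p := p)
    (n := a + p * x + (b + p * y)) (k := a + p * x)
  have hdiv : (a + p * x) / p = x := by
    rw [Nat.add_mul_div_left _ _ hp.pos, Nat.div_eq_of_lt ha, zero_add]
  rw [e, Nat.add_mul_mod_self_left, Nat.add_mul_mod_self_left, Nat.mod_eq_of_lt ha, hdiv,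
    Nat.add_mul_div_left _ _ hp.pos] at h₁
  rw [e]
  rcases lt_or_ge (a + b) p with h | h
  · rwa [Nat.mod_eq_of_lt h, Nat.div_eq_of_lt h, zero_add] at h₁
  · have hz : ((a + b) % p).choose a = 0 := by
      apply Nat.choose_eq_zero_of_lt
      rw [Nat.mod_eq_sub_mod h, Nat.mod_eq_of_lt (by omega)]
      omega
    have h₂ := Choose.choose_modEq_choose_mod_mul_choose_div_nat (p := p) (n := a + b) (k := a)
    rw [Nat.mod_eq_of_lt ha, hz, zero_mul] at h₂
    rw [hz, zero_mul] at h₁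
    exact h₁.trans (by simpa using (h₂.mul_right ((x + y).choose x)).symm)

theorem Nat.choose_add_modEq_prod_choose_digits {p : ℕ} (hp : p.Prime) (L : ℕ) (d e : ℕ → ℕ)
    (hd : ∀ k, d k < p) (he : ∀ k, e k < p) :
    (∑ k ∈ Finset.range L, d k * p ^ k + ∑ k ∈ Finset.range L, e k * p ^ k).choose
        (∑ k ∈ Finset.range L, d k * p ^ k) ≡
      ∏ k ∈ Finset.range L, (d k + e k).choose (d k) [MOD p] := by
  induction L generalizing d e with
  | zero => simp [Nat.ModEq.refl]
  | succ L ih =>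
    have key (c : ℕ → ℕ) : ∑ k ∈ Finset.range (L + 1), c k * p ^ k =
        c 0 + p * ∑ k ∈ Finset.range L, c (k + 1) * p ^ k := by
      rw [Finset.sum_range_succ', Finset.mul_sum, pow_zero, mul_one, add_comm]
      congr 1
      exact Finset.sum_congr rfl fun k _ => by ring
    rw [key, key, Finset.prod_range_succ', mul_comm (Finset.prod _ _)]
    exact (Nat.choose_add_modEq_choose_digit_mul hp (hd 0) (he 0) _ _).trans
      ((ih (fun k => d (k + 1)) (fun k => e (k + 1)) (fun _ => hd _) (fun _ => he _)).mul_left _)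

theorem Nat.div_pow_eq_zero_of_lt {q n k : ℕ} (hq : 1 < q) (h : n < k) : n / q ^ k = 0 :=
  Nat.div_eq_of_lt (h.trans (Nat.lt_pow_self hq))

theorem rhoStar_one {q : ℕ} (hq : 1 < q) (n : ℕ) : rhoStar q 1 n = n := by
  simp only [rhoStar, Equiv.Perm.one_apply, Nat.sum_range_div_pow_mod_mul_pow]
  exact Nat.mod_eq_of_lt (n.lt_succ_self.trans (Nat.lt_pow_self hq))

theorem rhoStar_eq_sum_range {q : ℕ} (hq : 1 < q) (ρ : Equiv.Perm ℕ) {n L : ℕ}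
    (hL : ∀ k < n + 1, ρ k < L) :
    rhoStar q ρ n = ∑ m ∈ Finset.range L, (n / q ^ ρ.symm m % q) * q ^ m := by
  rw [rhoStar, sum_range_eq_sum_range_perm_symm ρ _ hL]
  · simp
  · intro k hk
    simp [Nat.div_pow_eq_zero_of_lt hq hk]

theorem choose_rhoStar_add_modEq_prod {p : ℕ} (hp : p.Prime) (ρ : Equiv.Perm ℕ) (i j : ℕ) :
    (rhoStar p ρ i + rhoStar p ρ j).choose (rhoStar p ρ i) ≡
      ∏ k ∈ Finset.range (i + j + 1),
        (i / p ^ k % p + j / p ^ k % p).choose (i / p ^ k % p) [MOD p] := by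
  obtain ⟨L, hL⟩ : ∃ L, ∀ k < i + j + 1, ρ k < L :=
    ⟨(Finset.range (i + j + 1)).sup ρ + 1, fun k hk =>
      Nat.lt_succ_of_le (Finset.le_sup (Finset.mem_range.2 hk))⟩
  rw [rhoStar_eq_sum_range hp.one_lt ρ fun k hk => hL k (by omega),
    rhoStar_eq_sum_range hp.one_lt ρ fun k hk => hL k (by omega),
    prod_range_eq_prod_range_perm_symm ρ _ hL]
  · exact Nat.choose_add_modEq_prod_choose_digits hp L _ _
      (fun _ => Nat.mod_lt _ hp.pos) (fun _ => Nat.mod_lt _ hp.pos)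
  · intro k hk
    simp [Nat.div_pow_eq_zero_of_lt hp.one_lt (show i < k by omega)]

/-- `C(i + j, i) ≡ C(ρ_*(i) + ρ_*(j), ρ_*(i)) (mod p)` for the `p`-adic
digit permutation `ρ_*`. -/
theorem choose_add_modEq_choose_rhoStar_add (p : ℕ) (hp : p.Prime) (ρ : Equiv.Perm ℕ)
    (i j : ℕ) :
    Nat.choose (i + j) i ≡
      Nat.choose (rhoStar p ρ i + rhoStar p ρ j) (rhoStar p ρ i) [MOD p] := by
  have h := choose_rhoStar_add_modEq_prod hp 1 i j
  rw [rhoStar_one hp.one_lt, rhoStar_one hp.one_lt] at h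
  exact h.trans (choose_rhoStar_add_modEq_prod hp ρ i j).symm
end
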